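/- Let 0 < δ < 1, 0 < α < 1, and let G = (V, E) be a δ-dense graph on n vertices (every vertex has degree at least δ·n). Let k, k′ ≥ 1 be integers with n·(1 − δ)^k ≤ α and k·(1 − δ)^{k′} ≤ α. Choose k + k′ vertices independently and uniformly at random from V, letting R be the set formed by the first k samples and R′ the set formed by the last k′ samples. Then with probability at least (1 − α)², R′ is a 2-dominating set of G (every vertex of V is at graph distance at most 2 from R′). Equivalently, the number of tuples in V^{k+k′} for which the resulting R′ fails to be 2-dominating is at most (1 − (1 − α)²)·n^{k+k′}. -/

import Mathlib

open Finset in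
/-- In a graph of minimum degree at least `δ * |V|`, at most `|ι| * ((1 - δ) * |V|) ^ |κ|` of the
families `r : κ → V` leave some vertex `s i` without a neighbour among the `r j`. -/
theorem SimpleGraph.card_filter_exists_forall_not_adj_le {V ι κ : Type*} [Fintype V] [Fintype ι]
    [Fintype κ] [DecidableEq κ] (G : SimpleGraph V) [DecidableRel G.Adj] {δ : ℝ}
    (hdense : ∀ u : V, δ * Fintype.card V ≤ (G.degree u : ℝ)) (s : ι → V)
    [DecidablePred fun r : κ → V => ∃ i, ∀ j, ¬ G.Adj (s i) (r j)] :
    (#{r : κ → V | ∃ i, ∀ j, ¬ G.Adj (s i) (r j)} : ℝ)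
      ≤ Fintype.card ι * ((1 - δ) * Fintype.card V) ^ Fintype.card κ := by
  classical
  have hsub : ({r : κ → V | ∃ i, ∀ j, ¬ G.Adj (s i) (r j)} : Finset (κ → V)) ⊆
      univ.biUnion fun i => Fintype.piFinset fun _ : κ => (G.neighborFinset (s i))ᶜ := by
    intro r hr
    simpa using hr
  have hcard (i : ι) : (#(Fintype.piFinset fun _ : κ => (G.neighborFinset (s i))ᶜ) : ℝ)
      ≤ ((1 - δ) * Fintype.card V) ^ Fintype.card κ := by
    rw [Fintype.card_piFinset, prod_const, card_univ, Nat.cast_pow]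
    gcongr
    rw [card_compl, Nat.cast_sub (card_le_univ _), G.card_neighborFinset_eq_degree]
    linarith [hdense (s i)]
  calc (#{r : κ → V | ∃ i, ∀ j, ¬ G.Adj (s i) (r j)} : ℝ)
      ≤ ∑ i, (#(Fintype.piFinset fun _ : κ => (G.neighborFinset (s i))ᶜ) : ℝ) := by
        exact_mod_cast (card_le_card hsub).trans card_biUnion_le
    _ ≤ ∑ _i : ι, ((1 - δ) * Fintype.card V) ^ Fintype.card κ := sum_le_sum fun i _ => hcard i
    _ = _ := by simp

open Finset in
/-- A union bound for dependent events on a product: if `p` holds on at most a fraction `c` of `α`,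
and each `q a` holds on at most a fraction `c` of `β`, then `p a ∨ q a b` holds on at most a
fraction `1 - (1 - c) ^ 2` of the pairs. -/
theorem Finset.card_filter_or_le_of_card_filter_le {α β : Type*} [Fintype α] [Fintype β]
    (p : α → Prop) (q : α → β → Prop) [DecidablePred p] [∀ a, DecidablePred (q a)] {c : ℝ}
    (hc : c ≤ 1) (hp : (#{a | p a} : ℝ) ≤ c * Fintype.card α)
    (hq : ∀ a, (#{b | q a b} : ℝ) ≤ c * Fintype.card β) :
    (#{x : α × β | p x.1 ∨ q x.1 x.2} : ℝ)
      ≤ (1 - (1 - c) ^ 2) * (Fintype.card α * Fintype.card β) := by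
  classical
  have hsum : #{x : α × β | p x.1 ∨ q x.1 x.2} = ∑ a, #{b | p a ∨ q a b} := by
    simp only [card_filter, Fintype.sum_prod_type]
  have hfiber (a : α) : (#{b | p a ∨ q a b} : ℝ)
      ≤ c * Fintype.card β + if p a then (1 - c) * Fintype.card β else 0 := by
    by_cases h : p a
    · simp only [h, true_or, filter_true, card_univ, if_true]
      linarith
    · simpa [h] using hq a
  calc (#{x : α × β | p x.1 ∨ q x.1 x.2} : ℝ)
      ≤ ∑ a, (c * Fintype.card β + if p a then (1 - c) * Fintype.card β else 0) := by
        rw [hsum, Nat.cast_sum]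
        exact sum_le_sum fun a _ => hfiber a
    _ = Fintype.card α * (c * Fintype.card β) + #{a | p a} * ((1 - c) * Fintype.card β) := by
        rw [sum_add_distrib, ← sum_filter]
        simp
    _ ≤ Fintype.card α * (c * Fintype.card β)
          + c * Fintype.card α * ((1 - c) * Fintype.card β) := by
        have : 0 ≤ 1 - c := by linarith
        gcongr
    _ = _ := by ring


/-- In a δ-dense graph on `n` vertices, choose `k + k′` independent uniform
samples; let `R′` be the set formed by the last `k′` samples. If
`n·(1-δ)^k ≤ α` and `k·(1-δ)^{k′} ≤ α`, then `R′` is a 2-dominating set (every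
vertex is at distance at most 2 from `R′`) with probability at least `(1-α)²`:
the number of tuples for which `R′` fails to be 2-dominating is at most
`(1 - (1-α)²) · n^{k+k′}`. -/
theorem random_two_dominating_set {V : Type*} [Fintype V] (G : SimpleGraph V)
    [DecidableRel G.Adj] (n : ℕ) (hn : Fintype.card V = n)
    (δ : ℝ) (hδ0 : 0 < δ) (hδ1 : δ < 1)
    (α : ℝ) (hα0 : 0 < α) (hα1 : α < 1)
    (hdense : ∀ u : V, δ * n ≤ (G.degree u : ℝ))
    (k k' : ℕ) (hk : 1 ≤ k) (hk' : 1 ≤ k')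
    (hkα : (n : ℝ) * (1 - δ) ^ k ≤ α) (hk'α : (k : ℝ) * (1 - δ) ^ k' ≤ α) :
    (Nat.card {r : Fin (k + k') → V //
        ∃ v : V, ¬ ∃ u : V, (∃ i : Fin (k + k'), k ≤ (i : ℕ) ∧ r i = u) ∧
          ∃ w : G.Walk v u, w.length ≤ 2} : ℝ)
      ≤ (1 - (1 - α) ^ 2) * (n : ℝ) ^ (k + k') := by
  classical
  subst hn
  have hR : (Finset.card {a : Fin k → V | ∃ v, ∀ i, ¬ G.Adj v (a i)} : ℝ)
      ≤ α * Fintype.card (Fin k → V) := by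
    refine (G.card_filter_exists_forall_not_adj_le hdense fun v => v).trans ?_
    rw [mul_pow, ← mul_assoc, Fintype.card_fun, Fintype.card_fin, Nat.cast_pow]
    gcongr
  have hR' (a : Fin k → V) : (Finset.card {b : Fin k' → V | ∃ i, ∀ j, ¬ G.Adj (a i) (b j)} : ℝ)
      ≤ α * Fintype.card (Fin k' → V) := by
    refine (G.card_filter_exists_forall_not_adj_le hdense a).trans ?_
    rw [mul_pow, ← mul_assoc, Fintype.card_fun, Fintype.card_fin, Fintype.card_fin, Nat.cast_pow]
    gcongr
  have hbad := Finset.card_filter_or_le_of_card_filter_le _ _ hα1.le hR hR'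
  refine le_trans ?_ (hbad.trans_eq ?_)
  · rw [Nat.cast_le, ← Nat.card_eq_finsetCard]
    refine Nat.card_le_card_of_injective
      (fun r => ⟨(Fin.appendEquiv k k').symm r.1, ?_⟩) fun r s hrs => ?_
    · obtain ⟨r, v, hv⟩ := r
      simp only [Finset.mem_filter, Finset.mem_univ, true_and]
      by_contra! h
      obtain ⟨i, hi⟩ := h.1 v
      obtain ⟨j, hj⟩ := h.2 i
      exact hv ⟨_, ⟨Fin.natAdd k j, by simp, rfl⟩, .cons hi (.cons hj .nil), le_rfl⟩
    · exact Subtype.ext ((Fin.appendEquiv k k').symm.injective (congrArg Subtype.val hrs))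
  · simp [pow_add]
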